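/- Let D be the 2×2 integer matrix diag(1,2) and let J be the 4×4 integer block matrix [[0, D], [−D, 0]]. Let Γ_D = { R ∈ M₄(ℤ) : R · J · Rᵀ = J } be the symplectic group of matrices preserving this intersection form. Then for every nonzero vector v ∈ (ℤ/3ℤ)⁴ there exists R ∈ Γ_D such that the reduction of R modulo 3, acting on column vectors, maps the first standard basis vector e₁ = (1,0,0,0) to v. -/

import Mathlib

/-- The `4 × 4` integer matrix `J = [[0, D], [-D, 0]]` where `D = diag(1, 2)`. -/
def JMat : Matrix (Fin 4) (Fin 4) ℤ :=
  !![0, 0, 1, 0;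
     0, 0, 0, 2;
     -1, 0, 0, 0;
     0, -2, 0, 0]

/-- The alternating form `2 J⁻¹` on column vectors, up to sign. -/
def dualForm {S : Type*} [CommRing S] (x y : Fin 4 → S) : S :=
  2 * (x 0 * y 2 - x 2 * y 0) + (x 1 * y 3 - x 3 * y 1)

/-- The matrix of the transvection `x ↦ x + k * dualForm x u • u`. -/
def transvectionMat (k : ℤ) (u : Fin 4 → ℤ) : Matrix (Fin 4) (Fin 4) ℤ :=
  1 + k • Matrix.vecMulVec u ![2 * u 2, u 3, -2 * u 0, -u 1]

theorem transvectionMat_preserves (k : ℤ) (u : Fin 4 → ℤ) :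
    transvectionMat k u * JMat * (transvectionMat k u).transpose = JMat := by
  ext i j
  fin_cases i <;> fin_cases j <;>
    simp [transvectionMat, JMat, Matrix.mul_apply, Fin.sum_univ_four, Matrix.one_apply] <;> ring

theorem transvectionMat_mulVec (k : ℤ) (u : Fin 4 → ℤ) (w : Fin 4 → ZMod 3) :
    ((transvectionMat k u).map (Int.cast : ℤ → ZMod 3)).mulVec w =
      w + ((k : ZMod 3) * dualForm w (fun i => (u i : ZMod 3))) • fun i => (u i : ZMod 3) := by
  ext i
  fin_cases i <;>
    simp [transvectionMat, dualForm, Matrix.mulVec, dotProduct, Fin.sum_univ_four,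
      Matrix.one_apply] <;> ring

/-- `v` lies in the orbit of the first basis vector under the group preserving `J`. -/
def InOrbit (v : Fin 4 → ZMod 3) : Prop :=
  ∃ R : Matrix (Fin 4) (Fin 4) ℤ,
    R * JMat * R.transpose = JMat ∧
    (R.map (Int.cast : ℤ → ZMod 3)).mulVec (Pi.single 0 1) = v

theorem inOrbit_single : InOrbit (Pi.single 0 1) :=
  ⟨1, by simp, by rw [Matrix.map_one _ Int.cast_zero Int.cast_one, Matrix.one_mulVec]⟩

theorem InOrbit.of_dualForm_ne_zero {w v : Fin 4 → ZMod 3} (hw : InOrbit w)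
    (h : dualForm w v ≠ 0) : InOrbit v := by
  obtain ⟨R, hR, rfl⟩ := hw
  set w := (R.map (Int.cast : ℤ → ZMod 3)).mulVec (Pi.single 0 1) with hw
  choose u hu using fun i => ZMod.intCast_surjective (v i - w i)
  obtain ⟨k, hk⟩ := ZMod.intCast_surjective (dualForm w v)
  refine ⟨transvectionMat k u * R, ?_, ?_⟩
  · calc transvectionMat k u * R * JMat * (transvectionMat k u * R).transpose
        = transvectionMat k u * (R * JMat * R.transpose) * (transvectionMat k u).transpose := by
          simp only [Matrix.transpose_mul, Matrix.mul_assoc]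
      _ = JMat := by rw [hR, transvectionMat_preserves]
  · have hmap : (transvectionMat k u * R).map (Int.cast : ℤ → ZMod 3) =
        (transvectionMat k u).map Int.cast * R.map Int.cast :=
      Matrix.map_mul (f := Int.castRingHom (ZMod 3))
    have hform : dualForm w (fun i => v i - w i) = dualForm w v := by
      simp only [dualForm]; ring
    have hsq : ∀ x : ZMod 3, x ≠ 0 → x * x = 1 := by decide
    rw [hmap, ← Matrix.mulVec_mulVec, ← hw, transvectionMat_mulVec, hk]
    simp only [hu]
    rw [hform, hsq _ h]
    ext i
    simp

/-- For every nonzero `v ∈ (ℤ/3ℤ)⁴` there exists an integer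
matrix `R` preserving the symplectic form `J` of type `(1,2)` (i.e. `R J Rᵀ = J`)
whose reduction mod `3` maps the first standard basis vector to `v`. -/
theorem statement3 (v : Fin 4 → ZMod 3) (hv : v ≠ 0) :
    ∃ R : Matrix (Fin 4) (Fin 4) ℤ,
      R * JMat * R.transpose = JMat ∧
      (R.map (Int.cast : ℤ → ZMod 3)).mulVec (Pi.single 0 1) = v := by
  change InOrbit v
  have htwo : ∀ x : ZMod 3, 2 * x = 0 → x = 0 := by decide
  have hsum : ∀ x y : ZMod 3, x * x + y * y = 0 → x = 0 ∧ y = 0 := by decide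
  by_cases h2 : v 2 = 0
  · by_cases h0 : v 0 = 0
    · have hw : InOrbit ![0, v 3, 1, -v 1] :=
        inOrbit_single.of_dualForm_ne_zero (by simp [dualForm]; decide)
      refine hw.of_dualForm_ne_zero fun h => hv ?_
      obtain ⟨h3, h1⟩ := hsum (v 3) (v 1) (by simpa [dualForm, h0] using h)
      ext i
      fin_cases i <;> assumption
    · have hw : InOrbit ![0, 0, 1, 0] :=
        inOrbit_single.of_dualForm_ne_zero (by simp [dualForm]; decide)
      exact hw.of_dualForm_ne_zero fun h => h0 (htwo _ (by simpa [dualForm] using h))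
  · exact inOrbit_single.of_dualForm_ne_zero fun h => h2 (htwo _ (by simpa [dualForm] using h))
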